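/- The unrestricted left implication rule (→L) is admissible in both G4CK and G4WK: if ⊢ Γ ⇒ φ and ⊢ Γ,ψ ⇒ Δ then ⊢ Γ,φ→ψ ⇒ Δ, where ⊢ is either ⊢_G4CK or ⊢_G4WK. -/

import Mathlib

/-- Formulas of the modal language: φ ::= p | ⊥ | φ∧φ | φ∨φ | φ→φ | □φ | ◇φ. -/
inductive Form : Type
  | var : ℕ → Form
  | bot : Form
  | and : Form → Form → Form
  | or  : Form → Form → Form
  | imp : Form → Form → Form
  | box : Form → Form
  | dia : Form → Form
  deriving DecidableEq

/-- Helper for □⁻¹: remove an outer box. -/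
def unboxF : Form → Option Form
  | Form.box φ => some φ
  | _ => none

/-- □⁻¹Γ := {φ | □φ ∈ Γ}, as a multiset operation. -/
def boxInv (Γ : Multiset Form) : Multiset Form := Γ.filterMap unboxF

/-- ◇⁻¹Δ for a succedent Δ with at most one formula (modelled by `Option`). -/
def diaInv : Option Form → Option Form
  | some (Form.dia φ) => some φ
  | _ => none

/-- Provability in the sequent calculus G4CK: sequents Γ ⇒ δ with a
multiset antecedent and a single-formula succedent. -/
inductive G4CK : Multiset Form → Form → Prop
  | botL (Γ δ) : G4CK (Form.bot ::ₘ Γ) δ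
  | idP (Γ n) : G4CK (Form.var n ::ₘ Γ) (Form.var n)
  | andL (Γ φ ψ δ) : G4CK (φ ::ₘ ψ ::ₘ Γ) δ → G4CK (Form.and φ ψ ::ₘ Γ) δ
  | andR (Γ φ ψ) : G4CK Γ φ → G4CK Γ ψ → G4CK Γ (Form.and φ ψ)
  | orL (Γ φ ψ δ) : G4CK (φ ::ₘ Γ) δ → G4CK (ψ ::ₘ Γ) δ → G4CK (Form.or φ ψ ::ₘ Γ) δ
  | orR1 (Γ φ ψ) : G4CK Γ φ → G4CK Γ (Form.or φ ψ)
  | orR2 (Γ φ ψ) : G4CK Γ ψ → G4CK Γ (Form.or φ ψ)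
  | impR (Γ φ ψ) : G4CK (φ ::ₘ Γ) ψ → G4CK Γ (Form.imp φ ψ)
  | andImpL (Γ φ ψ χ δ) :
      G4CK (Form.imp φ (Form.imp ψ χ) ::ₘ Γ) δ →
      G4CK (Form.imp (Form.and φ ψ) χ ::ₘ Γ) δ
  | orImpL (Γ φ ψ χ δ) :
      G4CK (Form.imp φ χ ::ₘ Form.imp ψ χ ::ₘ Γ) δ →
      G4CK (Form.imp (Form.or φ ψ) χ ::ₘ Γ) δ
  | pImpL (Γ n φ δ) :
      G4CK (Form.var n ::ₘ φ ::ₘ Γ) δ →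
      G4CK (Form.var n ::ₘ Form.imp (Form.var n) φ ::ₘ Γ) δ
  | impImpL (Γ φ ψ χ δ) :
      G4CK (Form.imp ψ χ ::ₘ Γ) (Form.imp φ ψ) → G4CK (χ ::ₘ Γ) δ →
      G4CK (Form.imp (Form.imp φ ψ) χ ::ₘ Γ) δ
  | boxR (Γ φ) : G4CK (boxInv Γ) φ → G4CK Γ (Form.box φ)
  | boxImpL (Γ φ ψ δ) :
      G4CK (boxInv Γ) φ → G4CK (ψ ::ₘ Γ) δ →
      G4CK (Form.imp (Form.box φ) ψ ::ₘ Γ) δ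
  | diaImpL (Γ γ φ ψ δ) :
      G4CK (γ ::ₘ boxInv Γ) φ → G4CK (ψ ::ₘ Form.dia γ ::ₘ Γ) δ →
      G4CK (Form.imp (Form.dia φ) ψ ::ₘ Form.dia γ ::ₘ Γ) δ
  | diaL (Γ φ ψ) : G4CK (φ ::ₘ boxInv Γ) ψ → G4CK (Form.dia φ ::ₘ Γ) (Form.dia ψ)

/-- Provability in the sequent calculus G4WK: sequents Γ ⇒ Δ with a
multiset antecedent and a succedent with at most one formula (`Option Form`). -/
inductive G4WK : Multiset Form → Option Form → Prop
  | botL (Γ Δ) : G4WK (Form.bot ::ₘ Γ) Δ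
  | idP (Γ n) : G4WK (Form.var n ::ₘ Γ) (some (Form.var n))
  | andL (Γ φ ψ Δ) : G4WK (φ ::ₘ ψ ::ₘ Γ) Δ → G4WK (Form.and φ ψ ::ₘ Γ) Δ
  | andR (Γ φ ψ) : G4WK Γ (some φ) → G4WK Γ (some ψ) → G4WK Γ (some (Form.and φ ψ))
  | orL (Γ φ ψ Δ) : G4WK (φ ::ₘ Γ) Δ → G4WK (ψ ::ₘ Γ) Δ → G4WK (Form.or φ ψ ::ₘ Γ) Δ
  | orR1 (Γ φ ψ) : G4WK Γ (some φ) → G4WK Γ (some (Form.or φ ψ))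
  | orR2 (Γ φ ψ) : G4WK Γ (some ψ) → G4WK Γ (some (Form.or φ ψ))
  | impR (Γ φ ψ) : G4WK (φ ::ₘ Γ) (some ψ) → G4WK Γ (some (Form.imp φ ψ))
  | andImpL (Γ φ ψ χ Δ) :
      G4WK (Form.imp φ (Form.imp ψ χ) ::ₘ Γ) Δ →
      G4WK (Form.imp (Form.and φ ψ) χ ::ₘ Γ) Δ
  | orImpL (Γ φ ψ χ Δ) :
      G4WK (Form.imp φ χ ::ₘ Form.imp ψ χ ::ₘ Γ) Δ →
      G4WK (Form.imp (Form.or φ ψ) χ ::ₘ Γ) Δ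
  | pImpL (Γ n φ Δ) :
      G4WK (Form.var n ::ₘ φ ::ₘ Γ) Δ →
      G4WK (Form.var n ::ₘ Form.imp (Form.var n) φ ::ₘ Γ) Δ
  | impImpL (Γ φ ψ χ Δ) :
      G4WK (Form.imp ψ χ ::ₘ Γ) (some (Form.imp φ ψ)) → G4WK (χ ::ₘ Γ) Δ →
      G4WK (Form.imp (Form.imp φ ψ) χ ::ₘ Γ) Δ
  | boxR (Γ φ) : G4WK (boxInv Γ) (some φ) → G4WK Γ (some (Form.box φ))
  | boxImpL (Γ φ ψ Δ) :
      G4WK (boxInv Γ) (some φ) → G4WK (ψ ::ₘ Γ) Δ →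
      G4WK (Form.imp (Form.box φ) ψ ::ₘ Γ) Δ
  | diaImpL (Γ γ φ ψ Δ) :
      G4WK (γ ::ₘ boxInv Γ) (some φ) → G4WK (ψ ::ₘ Form.dia γ ::ₘ Γ) Δ →
      G4WK (Form.imp (Form.dia φ) ψ ::ₘ Form.dia γ ::ₘ Γ) Δ
  | diaL' (Γ φ Δ) : G4WK (φ ::ₘ boxInv Γ) (diaInv Δ) → G4WK (Form.dia φ ::ₘ Γ) Δ

/-- Axiom schemes of the generalised Hilbert calculus CKH:
intuitionistic axioms A1–A9 together with K_□ and K_◇. -/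
inductive CKAx : Form → Prop
  | a1 (φ ψ : Form) : CKAx (φ.imp (ψ.imp φ))
  | a2 (φ ψ χ : Form) : CKAx ((φ.imp (ψ.imp χ)).imp ((φ.imp ψ).imp (φ.imp χ)))
  | a3 (φ ψ : Form) : CKAx (φ.imp (φ.or ψ))
  | a4 (φ ψ : Form) : CKAx (ψ.imp (φ.or ψ))
  | a5 (φ ψ χ : Form) : CKAx ((φ.imp χ).imp ((ψ.imp χ).imp ((φ.or ψ).imp χ)))
  | a6 (φ ψ : Form) : CKAx ((φ.and ψ).imp φ)
  | a7 (φ ψ : Form) : CKAx ((φ.and ψ).imp ψ)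
  | a8 (φ ψ χ : Form) : CKAx ((φ.imp ψ).imp ((φ.imp χ).imp (φ.imp (ψ.and χ))))
  | a9 (φ : Form) : CKAx (Form.bot.imp φ)
  | kbox (φ ψ : Form) : CKAx ((φ.imp ψ).box.imp (φ.box.imp ψ.box))
  | kdia (φ ψ : Form) : CKAx ((φ.imp ψ).box.imp (φ.dia.imp ψ.dia))

/-- Axiom schemes of WKH: those of CKH together with N : ¬◇⊥. -/
inductive WKAx : Form → Prop
  | ck {φ : Form} : CKAx φ → WKAx φ
  | n : WKAx (Form.bot.dia.imp Form.bot)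

/-- Derivability Γ ⊢ φ in the generalised Hilbert calculus CKH. -/
inductive CKH : Set Form → Form → Prop
  | ax {Γ : Set Form} {φ : Form} : CKAx φ → CKH Γ φ
  | el {Γ : Set Form} {φ : Form} : φ ∈ Γ → CKH Γ φ
  | mp {Γ : Set Form} {φ ψ : Form} : CKH Γ φ → CKH Γ (φ.imp ψ) → CKH Γ ψ
  | nec {Γ : Set Form} {φ : Form} : CKH ∅ φ → CKH Γ φ.box

/-- Derivability Γ ⊢ φ in the generalised Hilbert calculus WKH. -/
inductive WKH : Set Form → Form → Prop
  | ax {Γ : Set Form} {φ : Form} : WKAx φ → WKH Γ φ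
  | el {Γ : Set Form} {φ : Form} : φ ∈ Γ → WKH Γ φ
  | mp {Γ : Set Form} {φ ψ : Form} : WKH Γ φ → WKH Γ (φ.imp ψ) → WKH Γ ψ
  | nec {Γ : Set Form} {φ : Form} : WKH ∅ φ → WKH Γ φ.box

/-- The set of propositional variables occurring in a formula. -/
def vars : Form → Set ℕ
  | .var n => {n}
  | .bot => ∅
  | .and φ ψ => vars φ ∪ vars ψ
  | .or φ ψ => vars φ ∪ vars ψ
  | .imp φ ψ => vars φ ∪ vars ψ
  | .box φ => vars φ
  | .dia φ => vars φ

/-- Variables occurring in a multiset of formulas. -/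
def varsM (Γ : Multiset Form) : Set ℕ := {n | ∃ φ ∈ Γ, n ∈ vars φ}

/-- Variables occurring in a succedent with at most one formula. -/
def varsO : Option Form → Set ℕ
  | none => ∅
  | some φ => vars φ

lemma Multiset.cons_rotate {α : Type*} (a b c : α) (s : Multiset α) :
    a ::ₘ b ::ₘ c ::ₘ s = b ::ₘ c ::ₘ a ::ₘ s := by
  rw [Multiset.cons_swap a b, Multiset.cons_swap a c]

@[simp] lemma boxInv_cons_box (φ : Form) (Γ : Multiset Form) :
    boxInv (φ.box ::ₘ Γ) = φ ::ₘ boxInv Γ :=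
  Multiset.filterMap_cons_some _ _ _ rfl

lemma boxInv_cons_of_unboxF_eq_none {φ : Form} (h : unboxF φ = none) (Γ : Multiset Form) :
    boxInv (φ ::ₘ Γ) = boxInv Γ :=
  Multiset.filterMap_cons_none _ _ h

@[simp] lemma boxInv_cons_imp (φ ψ : Form) (Γ : Multiset Form) :
    boxInv (φ.imp ψ ::ₘ Γ) = boxInv Γ :=
  boxInv_cons_of_unboxF_eq_none rfl Γ

@[simp] lemma boxInv_cons_dia (φ : Form) (Γ : Multiset Form) :
    boxInv (φ.dia ::ₘ Γ) = boxInv Γ :=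
  boxInv_cons_of_unboxF_eq_none rfl Γ

@[simp] lemma boxInv_add (Γ Λ : Multiset Form) : boxInv (Γ + Λ) = boxInv Γ + boxInv Λ :=
  Multiset.filterMap_add _ _ _

/-- A common presentation of `G4CK` and `G4WK`: the left rule for `◇` is the one of `G4WK`,
which may be applied to succedents that are not diamonds only if `W` holds. -/
inductive G4 (W : Prop) : Multiset Form → Option Form → Prop
  | botL (Γ Δ) : G4 W (Form.bot ::ₘ Γ) Δ
  | idP (Γ n) : G4 W (Form.var n ::ₘ Γ) (some (Form.var n))
  | andL (Γ φ ψ Δ) : G4 W (φ ::ₘ ψ ::ₘ Γ) Δ → G4 W (Form.and φ ψ ::ₘ Γ) Δ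
  | andR (Γ φ ψ) : G4 W Γ (some φ) → G4 W Γ (some ψ) → G4 W Γ (some (Form.and φ ψ))
  | orL (Γ φ ψ Δ) : G4 W (φ ::ₘ Γ) Δ → G4 W (ψ ::ₘ Γ) Δ → G4 W (Form.or φ ψ ::ₘ Γ) Δ
  | orR1 (Γ φ ψ) : G4 W Γ (some φ) → G4 W Γ (some (Form.or φ ψ))
  | orR2 (Γ φ ψ) : G4 W Γ (some ψ) → G4 W Γ (some (Form.or φ ψ))
  | impR (Γ φ ψ) : G4 W (φ ::ₘ Γ) (some ψ) → G4 W Γ (some (Form.imp φ ψ))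
  | andImpL (Γ φ ψ χ Δ) :
      G4 W (Form.imp φ (Form.imp ψ χ) ::ₘ Γ) Δ →
      G4 W (Form.imp (Form.and φ ψ) χ ::ₘ Γ) Δ
  | orImpL (Γ φ ψ χ Δ) :
      G4 W (Form.imp φ χ ::ₘ Form.imp ψ χ ::ₘ Γ) Δ →
      G4 W (Form.imp (Form.or φ ψ) χ ::ₘ Γ) Δ
  | pImpL (Γ n φ Δ) :
      G4 W (Form.var n ::ₘ φ ::ₘ Γ) Δ →
      G4 W (Form.var n ::ₘ Form.imp (Form.var n) φ ::ₘ Γ) Δ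
  | impImpL (Γ φ ψ χ Δ) :
      G4 W (Form.imp ψ χ ::ₘ Γ) (some (Form.imp φ ψ)) → G4 W (χ ::ₘ Γ) Δ →
      G4 W (Form.imp (Form.imp φ ψ) χ ::ₘ Γ) Δ
  | boxR (Γ φ) : G4 W (boxInv Γ) (some φ) → G4 W Γ (some (Form.box φ))
  | boxImpL (Γ φ ψ Δ) :
      G4 W (boxInv Γ) (some φ) → G4 W (ψ ::ₘ Γ) Δ →
      G4 W (Form.imp (Form.box φ) ψ ::ₘ Γ) Δ
  | diaImpL (Γ γ φ ψ Δ) :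
      G4 W (γ ::ₘ boxInv Γ) (some φ) → G4 W (ψ ::ₘ Form.dia γ ::ₘ Γ) Δ →
      G4 W (Form.imp (Form.dia φ) ψ ::ₘ Form.dia γ ::ₘ Γ) Δ
  | diaL (Γ φ Δ) : (W ∨ diaInv Δ ≠ none) → G4 W (φ ::ₘ boxInv Γ) (diaInv Δ) →
      G4 W (Form.dia φ ::ₘ Γ) Δ

lemma eq_dia_of_diaInv_eq_some {Δ : Option Form} {φ : Form} (h : diaInv Δ = some φ) :
    Δ = some φ.dia := by
  rcases Δ with _ | (_ | _ | _ | _ | _ | _ | χ) <;> simp_all [diaInv]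

namespace G4

variable {W : Prop} {Γ Λ : Multiset Form} {Δ : Option Form}

lemma weakening (h : G4 W Γ Δ) (Λ : Multiset Form) : G4 W (Γ + Λ) Δ := by
  induction h generalizing Λ with
  | botL => simpa using botL _ _
  | idP => simpa using idP _ _
  | andL Γ φ ψ Δ _ ih => simpa using andL _ _ _ _ (by simpa using ih Λ)
  | andR Γ φ ψ _ _ ih₁ ih₂ => exact andR _ _ _ (ih₁ Λ) (ih₂ Λ)
  | orL Γ φ ψ Δ _ _ ih₁ ih₂ =>
    simpa using orL _ _ _ _ (by simpa using ih₁ Λ) (by simpa using ih₂ Λ)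
  | orR1 Γ φ ψ _ ih => exact orR1 _ _ _ (ih Λ)
  | orR2 Γ φ ψ _ ih => exact orR2 _ _ _ (ih Λ)
  | impR Γ φ ψ _ ih => exact impR _ _ _ (by simpa using ih Λ)
  | andImpL Γ φ ψ χ Δ _ ih => simpa using andImpL _ _ _ _ _ (by simpa using ih Λ)
  | orImpL Γ φ ψ χ Δ _ ih => simpa using orImpL _ _ _ _ _ (by simpa using ih Λ)
  | pImpL Γ n φ Δ _ ih => simpa using pImpL _ _ _ _ (by simpa using ih Λ)
  | impImpL Γ φ ψ χ Δ _ _ ih₁ ih₂ =>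
    simpa using impImpL _ _ _ _ _ (by simpa using ih₁ Λ) (by simpa using ih₂ Λ)
  | boxR Γ φ _ ih => exact boxR _ _ (by simpa using ih (boxInv Λ))
  | boxImpL Γ φ ψ Δ _ _ ih₁ ih₂ =>
    simpa using boxImpL _ _ _ _ (by simpa using ih₁ (boxInv Λ)) (by simpa using ih₂ Λ)
  | diaImpL Γ γ φ ψ Δ _ _ ih₁ ih₂ =>
    simpa using diaImpL _ _ _ _ _ (by simpa using ih₁ (boxInv Λ)) (by simpa using ih₂ Λ)
  | diaL Γ φ Δ hW _ ih => simpa using diaL _ _ _ hW (by simpa using ih (boxInv Λ))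

lemma weakening_cons (h : G4 W Γ Δ) (φ : Form) : G4 W (φ ::ₘ Γ) Δ := by
  simpa [add_comm Γ] using h.weakening {φ}

lemma of_none (h : G4 W Γ none) (Δ : Option Form) : G4 W Γ Δ := by
  generalize hΔ : (none : Option Form) = Δ₀ at h
  induction h generalizing Δ with
  | botL => exact botL _ _
  | andL Γ φ ψ Δ₀ _ ih => exact andL _ _ _ _ (ih _ hΔ)
  | orL Γ φ ψ Δ₀ _ _ ih₁ ih₂ => exact orL _ _ _ _ (ih₁ _ hΔ) (ih₂ _ hΔ)
  | andImpL Γ φ ψ χ Δ₀ _ ih => exact andImpL _ _ _ _ _ (ih _ hΔ)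
  | orImpL Γ φ ψ χ Δ₀ _ ih => exact orImpL _ _ _ _ _ (ih _ hΔ)
  | pImpL Γ n φ Δ₀ _ ih => exact pImpL _ _ _ _ (ih _ hΔ)
  | impImpL Γ φ ψ χ Δ₀ h₁ _ _ ih₂ => exact impImpL _ _ _ _ _ h₁ (ih₂ _ hΔ)
  | boxImpL Γ φ ψ Δ₀ h₁ _ _ ih₂ => exact boxImpL _ _ _ _ h₁ (ih₂ _ hΔ)
  | diaImpL Γ γ φ ψ Δ₀ h₁ _ _ ih₂ => exact diaImpL _ _ _ _ _ h₁ (ih₂ _ hΔ)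
  | diaL Γ φ Δ₀ hW _ ih =>
    subst hΔ
    exact diaL _ _ _ (.inl (hW.resolve_right (by simp [diaInv]))) (ih _ rfl)
  | _ => cases hΔ

/-- `Inversion φ Λ` holds if an antecedent formula `φ` may be replaced by the multiset `Λ`. -/
inductive Inversion : Form → Multiset Form → Prop
  | and (φ ψ) : Inversion (Form.and φ ψ) {φ, ψ}
  | or_left (φ ψ) : Inversion (Form.or φ ψ) {φ}
  | or_right (φ ψ) : Inversion (Form.or φ ψ) {ψ}
  | and_imp (φ ψ χ) : Inversion (Form.imp (Form.and φ ψ) χ) {Form.imp φ (Form.imp ψ χ)}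
  | or_imp (φ ψ χ) : Inversion (Form.imp (Form.or φ ψ) χ) {Form.imp φ χ, Form.imp ψ χ}
  | var_imp (n χ) : Inversion (Form.imp (Form.var n) χ) {χ}
  | imp_imp (φ ψ χ) : Inversion (Form.imp (Form.imp φ ψ) χ) {χ}
  | box_imp (φ χ) : Inversion (Form.imp (Form.box φ) χ) {χ}
  | dia_imp (φ χ) : Inversion (Form.imp (Form.dia φ) χ) {χ}

lemma Inversion.boxInv_cons {φ : Form} (h : Inversion φ Λ) (Γ : Multiset Form) :
    boxInv (φ ::ₘ Γ) = boxInv Γ :=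
  boxInv_cons_of_unboxF_eq_none (by cases h <;> rfl) Γ

lemma Inversion.replace {X : Form} (hX : Inversion X Λ) (h : G4 W (X ::ₘ Γ) Δ) :
    G4 W (Γ + Λ) Δ := by
  generalize hΓ : X ::ₘ Γ = Γ₀ at h
  induction h generalizing Γ with
  | botL Γ' Δ =>
    obtain ⟨rfl, rfl⟩ | ⟨-, Ξ, rfl, rfl⟩ := Multiset.cons_eq_cons.1 hΓ
    · cases hX
    · simpa using botL _ _
  | idP Γ' n =>
    obtain ⟨rfl, rfl⟩ | ⟨-, Ξ, rfl, rfl⟩ := Multiset.cons_eq_cons.1 hΓ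
    · cases hX
    · simpa using idP _ _
  | andL Γ' φ ψ Δ h ih =>
    obtain ⟨rfl, rfl⟩ | ⟨-, Ξ, rfl, rfl⟩ := Multiset.cons_eq_cons.1 hΓ
    · cases hX
      simpa [add_comm Γ] using h
    · simpa using andL _ _ _ _ (by simpa using ih (Γ := φ ::ₘ ψ ::ₘ Ξ) (Multiset.cons_rotate _ _ _ _))
  | andR Γ' φ ψ _ _ ih₁ ih₂ => exact andR _ _ _ (ih₁ hΓ) (ih₂ hΓ)
  | orL Γ' φ ψ Δ h₁ h₂ ih₁ ih₂ =>
    obtain ⟨rfl, rfl⟩ | ⟨-, Ξ, rfl, rfl⟩ := Multiset.cons_eq_cons.1 hΓ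
    · cases hX
      · simpa [add_comm Γ] using h₁
      · simpa [add_comm Γ] using h₂
    · simpa using orL _ _ _ _
        (by simpa using ih₁ (Γ := φ ::ₘ Ξ) (Multiset.cons_swap _ _ _))
        (by simpa using ih₂ (Γ := ψ ::ₘ Ξ) (Multiset.cons_swap _ _ _))
  | orR1 Γ' φ ψ _ ih => exact orR1 _ _ _ (ih hΓ)
  | orR2 Γ' φ ψ _ ih => exact orR2 _ _ _ (ih hΓ)
  | impR Γ' φ ψ _ ih =>
    subst hΓ
    exact impR _ _ _ (by simpa using ih (Γ := φ ::ₘ Γ) (Multiset.cons_swap _ _ _))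
  | andImpL Γ' φ ψ χ Δ h ih =>
    obtain ⟨rfl, rfl⟩ | ⟨-, Ξ, rfl, rfl⟩ := Multiset.cons_eq_cons.1 hΓ
    · cases hX
      simpa [add_comm Γ] using h
    · simpa using andImpL _ _ _ _ _
        (by simpa using ih (Γ := _ ::ₘ Ξ) (Multiset.cons_swap _ _ _))
  | orImpL Γ' φ ψ χ Δ h ih =>
    obtain ⟨rfl, rfl⟩ | ⟨-, Ξ, rfl, rfl⟩ := Multiset.cons_eq_cons.1 hΓ
    · cases hX
      simpa [add_comm Γ] using h
    · simpa using orImpL _ _ _ _ _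
        (by simpa using ih (Γ := φ.imp χ ::ₘ ψ.imp χ ::ₘ Ξ) (Multiset.cons_rotate _ _ _ _))
  | pImpL Γ' n φ Δ h ih =>
    obtain ⟨rfl, rfl⟩ | ⟨-, Ξ, rfl, hΞ⟩ := Multiset.cons_eq_cons.1 hΓ
    · cases hX
    obtain ⟨rfl, rfl⟩ | ⟨-, Θ, rfl, rfl⟩ := Multiset.cons_eq_cons.1 hΞ
    · cases hX
      simpa [add_comm Γ', Multiset.cons_swap] using h
    · simpa using pImpL _ _ _ _
        (by simpa using ih (Γ := .var n ::ₘ φ ::ₘ Θ) (Multiset.cons_rotate _ _ _ _))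
  | impImpL Γ' φ ψ χ Δ h₁ h₂ ih₁ ih₂ =>
    obtain ⟨rfl, rfl⟩ | ⟨-, Ξ, rfl, rfl⟩ := Multiset.cons_eq_cons.1 hΓ
    · cases hX
      simpa [add_comm Γ] using h₂
    · simpa using impImpL _ _ _ _ _
        (by simpa using ih₁ (Γ := ψ.imp χ ::ₘ Ξ) (Multiset.cons_swap _ _ _))
        (by simpa using ih₂ (Γ := χ ::ₘ Ξ) (Multiset.cons_swap _ _ _))
  | boxR Γ' φ h _ =>
    subst hΓ
    rw [hX.boxInv_cons] at h
    exact boxR _ _ (by simpa using h.weakening _)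
  | boxImpL Γ' φ ψ Δ h₁ h₂ _ ih₂ =>
    obtain ⟨rfl, rfl⟩ | ⟨-, Ξ, rfl, rfl⟩ := Multiset.cons_eq_cons.1 hΓ
    · cases hX
      simpa [add_comm Γ] using h₂
    · rw [hX.boxInv_cons] at h₁
      simpa using boxImpL _ _ _ _ (by simpa using h₁.weakening _)
        (by simpa using ih₂ (Γ := ψ ::ₘ Ξ) (Multiset.cons_swap _ _ _))
  | diaImpL Γ' γ φ ψ Δ h₁ h₂ _ ih₂ =>
    obtain ⟨rfl, rfl⟩ | ⟨-, Ξ, rfl, hΞ⟩ := Multiset.cons_eq_cons.1 hΓ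
    · cases hX
      simpa [add_comm Γ', Multiset.cons_swap ψ] using h₂
    obtain ⟨rfl, rfl⟩ | ⟨-, Θ, rfl, rfl⟩ := Multiset.cons_eq_cons.1 hΞ
    · cases hX
    · rw [hX.boxInv_cons] at h₁
      simpa using diaImpL _ _ _ _ _ (by simpa using h₁.weakening _)
        (by simpa using ih₂ (Γ := ψ ::ₘ γ.dia ::ₘ Θ) (Multiset.cons_rotate _ _ _ _))
  | diaL Γ' φ Δ hW h _ =>
    obtain ⟨rfl, rfl⟩ | ⟨-, Ξ, rfl, rfl⟩ := Multiset.cons_eq_cons.1 hΓ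
    · cases hX
    · rw [hX.boxInv_cons] at h
      simpa using diaL _ _ _ hW (by simpa using h.weakening _)

lemma Inversion.replace_snd {X A : Form} (hX : Inversion X Λ)
    (h : G4 W (A ::ₘ X ::ₘ Γ) Δ) : G4 W (A ::ₘ (Γ + Λ)) Δ := by
  rw [Multiset.cons_swap] at h
  simpa using hX.replace h

lemma impL {φ ψ : Form} (h₁ : G4 W Γ (some φ)) (h₂ : G4 W (ψ ::ₘ Γ) Δ) :
    G4 W (φ.imp ψ ::ₘ Γ) Δ := by
  generalize hφ : some φ = Δ₀ at h₁
  induction h₁ generalizing φ ψ Δ with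
  | botL => rw [Multiset.cons_swap]; exact botL _ _
  | idP Γ n =>
    cases hφ
    rw [Multiset.cons_swap] at h₂ ⊢
    exact pImpL _ _ _ _ h₂
  | andL Γ α β _ _ ih =>
    rw [Multiset.cons_swap]
    have h := ih (by simpa [add_comm Γ] using (Inversion.and α β).replace_snd h₂) hφ
    refine andL _ _ _ _ ?_
    convert h using 1
    simp only [← Multiset.singleton_add]; abel
  | andR Γ α β _ _ ih₁ ih₂ =>
    cases hφ
    exact andImpL _ _ _ _ _ (ih₁ (ih₂ h₂ rfl) rfl)
  | orL Γ α β _ _ _ ih₁ ih₂ =>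
    rw [Multiset.cons_swap]
    have h := ih₁ (by simpa [add_comm Γ] using (Inversion.or_left α β).replace_snd h₂) hφ
    have h' := ih₂ (by simpa [add_comm Γ] using (Inversion.or_right α β).replace_snd h₂) hφ
    rw [Multiset.cons_swap] at h h'
    exact orL _ _ _ _ h h'
  | orR1 Γ α β _ ih =>
    cases hφ
    refine orImpL _ _ _ _ _ ?_
    rw [Multiset.cons_swap]
    exact (ih h₂ rfl).weakening_cons _
  | orR2 Γ α β _ ih =>
    cases hφ
    exact orImpL _ _ _ _ _ ((ih h₂ rfl).weakening_cons _)
  | impR Γ α β h _ =>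
    cases hφ
    exact impImpL _ _ _ _ _ ((impR _ _ _ h).weakening_cons _) h₂
  | andImpL Γ α β χ _ _ ih =>
    rw [Multiset.cons_swap]
    have h := ih (by simpa [add_comm Γ] using (Inversion.and_imp α β χ).replace_snd h₂) hφ
    rw [Multiset.cons_swap] at h
    exact andImpL _ _ _ _ _ h
  | orImpL Γ α β χ _ _ ih =>
    rw [Multiset.cons_swap]
    have h := ih (by simpa [add_comm Γ] using (Inversion.or_imp α β χ).replace_snd h₂) hφ
    refine orImpL _ _ _ _ _ ?_
    convert h using 1
    simp only [← Multiset.singleton_add]; abel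
  | pImpL Γ n χ _ _ ih =>
    have h₃ : G4 W (ψ ::ₘ .var n ::ₘ χ ::ₘ Γ) Δ := by
      rw [Multiset.cons_swap (Form.var n)] at h₂
      convert (Inversion.var_imp n χ).replace_snd h₂ using 1
      simp only [← Multiset.singleton_add]; abel
    convert pImpL (φ.imp ψ ::ₘ Γ) n χ Δ ?_ using 1
    · simp only [← Multiset.singleton_add]; abel
    · convert ih h₃ hφ using 1
      simp only [← Multiset.singleton_add]; abel
  | impImpL Γ α β χ _ h _ _ ih₂ =>
    rw [Multiset.cons_swap]
    have h' := ih₂ (by simpa [add_comm Γ] using (Inversion.imp_imp α β χ).replace_snd h₂) hφ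
    rw [Multiset.cons_swap] at h'
    refine impImpL _ _ _ _ _ ?_ h'
    rw [Multiset.cons_swap]
    exact h.weakening_cons _
  | boxR Γ α h _ =>
    cases hφ
    exact boxImpL _ _ _ _ h h₂
  | boxImpL Γ α χ _ h _ _ ih₂ =>
    rw [Multiset.cons_swap]
    have h' := ih₂ (by simpa [add_comm Γ] using (Inversion.box_imp α χ).replace_snd h₂) hφ
    rw [Multiset.cons_swap] at h'
    exact boxImpL _ _ _ _ (by simpa using h) h'
  | diaImpL Γ γ α χ _ h _ _ ih₂ =>
    have h₃ := ih₂ (by simpa [add_comm Γ, Multiset.cons_swap χ] using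
      (Inversion.dia_imp α χ).replace_snd h₂) hφ
    convert diaImpL (φ.imp ψ ::ₘ Γ) γ α χ Δ (by simpa using h) ?_ using 1
    · simp only [← Multiset.singleton_add]; abel
    · convert h₃ using 1
      simp only [← Multiset.singleton_add]; abel
  | diaL Γ γ Δ₀ hW h _ =>
    subst hφ
    cases hd : diaInv (some φ) with
    | none =>
      rw [hd] at h hW
      rw [Multiset.cons_swap]
      exact diaL _ _ _ (.inl (by simpa using hW)) (by simpa using h.of_none _)
    | some χ =>
      cases eq_dia_of_diaInv_eq_some hd
      exact diaImpL _ _ _ _ _ h h₂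

end G4

lemma G4CK.toG4 {Γ : Multiset Form} {φ : Form} (h : G4CK Γ φ) : G4 False Γ (some φ) := by
  induction h with
  | diaL Γ φ ψ _ ih => exact .diaL _ _ _ (.inr (by simp [diaInv])) ih
  | orR2 _ _ _ _ ih => exact .orR2 _ _ _ ih
  | _ => constructor <;> assumption

lemma G4.toG4CK {Γ : Multiset Form} {φ : Form} (h : G4 False Γ (some φ)) : G4CK Γ φ := by
  generalize hΔ : some φ = Δ at h
  induction h generalizing φ with
  | diaL Γ γ Δ hW _ ih =>
    obtain ⟨χ, hχ⟩ := Option.ne_none_iff_exists'.1 (hW.resolve_left id)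
    cases hΔ.trans (eq_dia_of_diaInv_eq_some hχ)
    exact .diaL _ _ _ (ih hχ.symm)
  | andR Γ α β _ _ ih₁ ih₂ => cases hΔ; exact .andR _ _ _ (ih₁ rfl) (ih₂ rfl)
  | orR2 Γ α β _ ih => cases hΔ; exact .orR2 _ _ _ (ih rfl)
  | _ => cases hΔ; constructor <;> apply_assumption <;> rfl

lemma g4WK_iff_g4 {Γ : Multiset Form} {Δ : Option Form} : G4WK Γ Δ ↔ G4 True Γ Δ := by
  constructor <;> intro h
  · induction h with
    | diaL' Γ φ Δ _ ih => exact .diaL _ _ _ (.inl trivial) ih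
    | orR2 _ _ _ _ ih => exact .orR2 _ _ _ ih
    | _ => constructor <;> assumption
  · induction h with
    | diaL Γ φ Δ _ _ ih => exact .diaL' _ _ _ ih
    | orR2 _ _ _ _ ih => exact .orR2 _ _ _ ih
    | _ => constructor <;> assumption

/-- The unrestricted left implication rule (→L) is admissible in both
G4CK and G4WK: from Γ ⇒ φ and Γ,ψ ⇒ Δ infer Γ,φ→ψ ⇒ Δ. -/
theorem impL_admissible :
    (∀ (Γ : Multiset Form) (φ ψ δ : Form),
      G4CK Γ φ → G4CK (ψ ::ₘ Γ) δ → G4CK (Form.imp φ ψ ::ₘ Γ) δ) ∧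
    (∀ (Γ : Multiset Form) (φ ψ : Form) (Δ : Option Form),
      G4WK Γ (some φ) → G4WK (ψ ::ₘ Γ) Δ → G4WK (Form.imp φ ψ ::ₘ Γ) Δ) := by
  exact ⟨fun _ _ _ _ h₁ h₂ => (h₁.toG4.impL h₂.toG4).toG4CK,
    fun _ _ _ _ h₁ h₂ => g4WK_iff_g4.2 ((g4WK_iff_g4.1 h₁).impL (g4WK_iff_g4.1 h₂))⟩
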